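/- Let c = (c_1, …, c_q), d = (d_1, …, d_{q−x}) and a = (a_1, …, a_x) be nonincreasing sequences of integers with q ≥ x ≥ 1. If c ≺′ (d, a), then the sequence (c_1, …, c_x) is majorized by (a_1 + K, a_2, …, a_x), where K = Σ_{i=1}^{q−x} (d_i − c_{i+x}); that is, Σ_{i=1}^{j} c_i ≤ a_1 + K + Σ_{i=2}^{j} a_i for 1 ≤ j ≤ x − 1, and Σ_{i=1}^{x} c_i = a_1 + K + Σ_{i=2}^{x} a_i. -/

import Mathlib

/-- Index `h_j = min{ i : d_{i-j+1} < g_i }` from the definition of generalized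
majorization, with the conventions `d_i = +∞` for `i < 1` (hence `j ≤ i`) and
`d_i = -∞` for `i > m` (hence the disjunct `m < i - j + 1`). -/
noncomputable def hIdx (m : ℕ) (d g : ℕ → ℤ) (j : ℕ) : ℕ :=
  sInf {i : ℕ | j ≤ i ∧ (m < i - j + 1 ∨ d (i - j + 1) < g i)}

/-- Generalized majorization `g ≺′ (d, a)` for nonincreasing integer sequences
`d = (d_1, …, d_m)`, `a = (a_1, …, a_s)` and `g = (g_1, …, g_{m+s})`:
(i) `d_i ≥ g_{i+s}` for `1 ≤ i ≤ m`;
(ii) `Σ_{i=1}^{h_j} g_i − Σ_{i=1}^{h_j−j} d_i ≤ Σ_{i=1}^{j} a_i` for `1 ≤ j ≤ s`;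
(iii) `Σ_{i=1}^{m+s} g_i = Σ_{i=1}^{m} d_i + Σ_{i=1}^{s} a_i`. -/
def GenMaj (m s : ℕ) (d a g : ℕ → ℤ) : Prop :=
  (∀ i, 1 ≤ i → i ≤ m → g (i + s) ≤ d i) ∧
  (∀ j, 1 ≤ j → j ≤ s →
    (∑ i ∈ Finset.Icc 1 (hIdx m d g j), g i)
      - (∑ i ∈ Finset.Icc 1 (hIdx m d g j - j), d i) ≤ ∑ i ∈ Finset.Icc 1 j, a i) ∧
  (∑ i ∈ Finset.Icc 1 (m + s), g i)
    = (∑ i ∈ Finset.Icc 1 m, d i) + ∑ i ∈ Finset.Icc 1 s, a i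

/-!
STATEMENT 10: Let c = (c_1, …, c_q), d = (d_1, …, d_{q−x}) and
a = (a_1, …, a_x) be nonincreasing sequences of integers with q ≥ x ≥ 1.
If c ≺′ (d, a), then the sequence (c_1, …, c_x) is majorized by
(a_1 + K, a_2, …, a_x), where K = Σ_{i=1}^{q−x} (d_i − c_{i+x}); that is,
Σ_{i=1}^{j} c_i ≤ a_1 + K + Σ_{i=2}^{j} a_i for 1 ≤ j ≤ x − 1, and
Σ_{i=1}^{x} c_i = a_1 + K + Σ_{i=2}^{x} a_i.
-/

theorem aux_split (f : ℕ → ℤ) (j k : ℕ) : ∑ i ∈ Finset.Icc 1 (k + j), f i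
    = ∑ i ∈ Finset.Icc 1 j, f i + ∑ i ∈ Finset.Icc 1 k, f (i + j) := by
  induction k with
  | zero => simp
  | succ k ih =>
    rw [show k + 1 + j = (k + j) + 1 by ring, Finset.sum_Icc_succ_top (by omega),
      Finset.sum_Icc_succ_top (by omega), ih, show k + 1 + j = (k + j) + 1 by ring]
    ring

theorem aux_head (f : ℕ → ℤ) (j : ℕ) (hj : 1 ≤ j) : ∑ i ∈ Finset.Icc 1 j, f i
    = f 1 + ∑ i ∈ Finset.Icc 2 j, f i := by
  induction j, hj using Nat.le_induction with
  | base => simp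
  | succ n hn ih =>
    rw [Finset.sum_Icc_succ_top (by omega), Finset.sum_Icc_succ_top (by omega), ih]
    ring

theorem stmt10 (q x : ℕ) (c d a : ℕ → ℤ) (hx : 1 ≤ x) (hxq : x ≤ q)
    (hc : ∀ i j, 1 ≤ i → i ≤ j → j ≤ q → c j ≤ c i)
    (hd : ∀ i j, 1 ≤ i → i ≤ j → j ≤ q - x → d j ≤ d i)
    (ha : ∀ i j, 1 ≤ i → i ≤ j → j ≤ x → a j ≤ a i)
    (hmaj : GenMaj (q - x) x d a c) :
    (∀ j, 1 ≤ j → j ≤ x - 1 →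
      (∑ i ∈ Finset.Icc 1 j, c i)
        ≤ a 1 + (∑ i ∈ Finset.Icc 1 (q - x), (d i - c (i + x)))
          + ∑ i ∈ Finset.Icc 2 j, a i) ∧
    (∑ i ∈ Finset.Icc 1 x, c i)
      = a 1 + (∑ i ∈ Finset.Icc 1 (q - x), (d i - c (i + x)))
        + ∑ i ∈ Finset.Icc 2 x, a i := by
  obtain ⟨h1, h2, h3⟩ := hmaj
  refine ⟨?_, ?_⟩
  · intro j hj hjx
    have h := h2 j hj (by omega)
    have hmem : q - x + j ∈
        {i : ℕ | j ≤ i ∧ (q - x < i - j + 1 ∨ d (i - j + 1) < c i)} :=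
      ⟨by omega, Or.inl (by omega)⟩
    have hle : hIdx (q - x) d c j ≤ q - x + j := Nat.sInf_le hmem
    have hge : j ≤ hIdx (q - x) d c j := (Nat.sInf_mem ⟨_, hmem⟩).1
    obtain ⟨k, hk⟩ := Nat.exists_eq_add_of_le' hge
    rw [hk, Nat.add_sub_cancel, aux_split, aux_head a j hj] at h
    have e1 : ∑ i ∈ Finset.Icc 1 k, (d i - c (i + j))
        ≤ ∑ i ∈ Finset.Icc 1 k, (d i - c (i + x)) := by
      apply Finset.sum_le_sum
      intro i hi
      rw [Finset.mem_Icc] at hi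
      have := hc (i + j) (i + x) (by omega) (by omega) (by omega)
      linarith
    have e2 : ∑ i ∈ Finset.Icc 1 k, (d i - c (i + x))
        ≤ ∑ i ∈ Finset.Icc 1 (q - x), (d i - c (i + x)) := by
      apply Finset.sum_le_sum_of_subset_of_nonneg
      · exact Finset.Icc_subset_Icc le_rfl (by omega)
      · intro i hi _
        rw [Finset.mem_Icc] at hi
        have := h1 i hi.1 hi.2
        linarith
    rw [Finset.sum_sub_distrib] at e1
    linarith
  · rw [aux_split, aux_head a x hx] at h3
    rw [Finset.sum_sub_distrib]
    linarith
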